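/- The matrix-valued function A is R-invariant: for every x ∈ ℝ², A(Rᵀ x) = Rᵀ A(x) R, where Rᵀ x denotes the action of the transpose of R on the column vector x. -/

import Mathlib

open Matrix
open scoped ComplexConjugate

/-- Euclidean dot product on `ℝ²`. -/
noncomputable def dot (a b : Fin 2 → ℝ) : ℝ := ∑ i, a i * b i

/-- Honeycomb lattice vector `v₁ = (√3/2, 1/2)`. -/
noncomputable def v₁ : Fin 2 → ℝ := ![Real.sqrt 3 / 2, 1 / 2]

/-- Honeycomb lattice vector `v₂ = (√3/2, −1/2)`. -/
noncomputable def v₂ : Fin 2 → ℝ := ![Real.sqrt 3 / 2, -(1 / 2)]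

/-- Dual lattice vector `k₁ = (4π/√3)(1/2, √3/2)`. -/
noncomputable def k₁ : Fin 2 → ℝ :=
  (4 * Real.pi / Real.sqrt 3) • ![1 / 2, Real.sqrt 3 / 2]

/-- Dual lattice vector `k₂ = (4π/√3)(1/2, −√3/2)`. -/
noncomputable def k₂ : Fin 2 → ℝ :=
  (4 * Real.pi / Real.sqrt 3) • ![1 / 2, -(Real.sqrt 3 / 2)]

/-- `k₃ = −k₁ − k₂`. -/
noncomputable def k₃ : Fin 2 → ℝ := -k₁ - k₂

/-- The clockwise rotation by `2π/3` about the origin. -/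
noncomputable def R : Matrix (Fin 2) (Fin 2) ℝ :=
  !![-(1 / 2), Real.sqrt 3 / 2; -(Real.sqrt 3 / 2), -(1 / 2)]

/-- The lowest-Fourier-component honeycomb structured material weight
`A(x) = a₀ I + C e^{i k₁·x} + R C Rᵀ e^{i k₂·x} + Rᵀ C R e^{i k₃·x}
      + Cᵀ e^{−i k₁·x} + R Cᵀ Rᵀ e^{−i k₂·x} + Rᵀ Cᵀ R e^{−i k₃·x}`. -/
noncomputable def A (a₀ : ℝ) (C : Matrix (Fin 2) (Fin 2) ℝ) (x : Fin 2 → ℝ) :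
    Matrix (Fin 2) (Fin 2) ℂ :=
  (a₀ : ℂ) • 1
  + Complex.exp (Complex.I * (dot k₁ x : ℝ)) • (C.map Complex.ofReal)
  + Complex.exp (Complex.I * (dot k₂ x : ℝ)) • ((R * C * Rᵀ).map Complex.ofReal)
  + Complex.exp (Complex.I * (dot k₃ x : ℝ)) • ((Rᵀ * C * R).map Complex.ofReal)
  + Complex.exp (-(Complex.I * (dot k₁ x : ℝ))) • (Cᵀ.map Complex.ofReal)
  + Complex.exp (-(Complex.I * (dot k₂ x : ℝ))) • ((R * Cᵀ * Rᵀ).map Complex.ofReal)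
  + Complex.exp (-(Complex.I * (dot k₃ x : ℝ))) • ((Rᵀ * Cᵀ * R).map Complex.ofReal)

lemma dot_mulVec_transpose (M : Matrix (Fin 2) (Fin 2) ℝ) (k x : Fin 2 → ℝ) :
    dot k (Mᵀ.mulVec x) = dot (M.mulVec k) x := by
  simp only [dot, mulVec, dotProduct, Fin.sum_univ_two, transpose_apply]
  ring

lemma R_mulVec_k₁ : R.mulVec k₁ = k₂ := by
  have h : Real.sqrt 3 ^ 2 = 3 := Real.sq_sqrt (by norm_num)
  ext i
  fin_cases i <;> simp [R, k₁, k₂, mulVec, dotProduct, Fin.sum_univ_two] <;>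
    field_simp <;> linarith

lemma R_mulVec_k₂ : R.mulVec k₂ = k₃ := by
  have h : Real.sqrt 3 ^ 2 = 3 := Real.sq_sqrt (by norm_num)
  ext i
  fin_cases i <;> simp [R, k₁, k₂, k₃, mulVec, dotProduct, Fin.sum_univ_two] <;>
    field_simp <;> linarith

lemma R_mulVec_k₃ : R.mulVec k₃ = k₁ := by
  have h : Real.sqrt 3 ^ 2 = 3 := Real.sq_sqrt (by norm_num)
  ext i
  fin_cases i <;> simp [R, k₁, k₂, k₃, mulVec, dotProduct, Fin.sum_univ_two] <;>
    field_simp <;> linarith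

lemma R_mul_R : R * R = Rᵀ := by
  have h : Real.sqrt 3 ^ 2 = 3 := Real.sq_sqrt (by norm_num)
  ext i j
  fin_cases i <;> fin_cases j <;> simp [R, mul_apply, Fin.sum_univ_two] <;> linarith

lemma R_transpose_mul_R : Rᵀ * R = 1 := by
  have h : Real.sqrt 3 ^ 2 = 3 := Real.sq_sqrt (by norm_num)
  ext i j
  fin_cases i <;> fin_cases j <;> simp [R, mul_apply, Fin.sum_univ_two] <;> linarith

lemma R_transpose_mul_R_transpose : Rᵀ * Rᵀ = R := by
  rw [← transpose_mul, R_mul_R, transpose_transpose]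

lemma R_conj_map_ofReal (M : Matrix (Fin 2) (Fin 2) ℝ) :
    Rᵀ.map Complex.ofReal * M.map Complex.ofReal * R.map Complex.ofReal
      = (Rᵀ * M * R).map Complex.ofReal := by
  have h (P Q : Matrix (Fin 2) (Fin 2) ℝ) :
      (P * Q).map Complex.ofReal = P.map Complex.ofReal * Q.map Complex.ofReal :=
    Matrix.map_mul (f := Complex.ofRealHom)
  rw [h, h]

lemma R_conj_conj_transpose (M : Matrix (Fin 2) (Fin 2) ℝ) :
    Rᵀ * (R * M * Rᵀ) * R = M := by
  calc Rᵀ * (R * M * Rᵀ) * R = (Rᵀ * R) * M * (Rᵀ * R) := by simp only [Matrix.mul_assoc]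
    _ = M := by rw [R_transpose_mul_R, Matrix.one_mul, Matrix.mul_one]

lemma R_conj_conj (M : Matrix (Fin 2) (Fin 2) ℝ) :
    Rᵀ * (Rᵀ * M * R) * R = R * M * Rᵀ := by
  calc Rᵀ * (Rᵀ * M * R) * R = (Rᵀ * Rᵀ) * M * (R * R) := by simp only [Matrix.mul_assoc]
    _ = R * M * Rᵀ := by rw [R_transpose_mul_R_transpose, R_mul_R]

/-- `A` is `R`-invariant: `A(Rᵀ x) = Rᵀ A(x) R` for every `x ∈ ℝ²`. -/
theorem A_R_invariant (a₀ : ℝ) (C : Matrix (Fin 2) (Fin 2) ℝ) (x : Fin 2 → ℝ) :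
    A a₀ C (Rᵀ.mulVec x)
      = (Rᵀ.map Complex.ofReal) * A a₀ C x * (R.map Complex.ofReal) := by
  have h1 : Rᵀ.map Complex.ofReal * R.map Complex.ofReal = 1 := by
    have h := R_conj_map_ofReal 1
    simpa [R_transpose_mul_R] using h
  simp only [A, dot_mulVec_transpose, R_mulVec_k₁, R_mulVec_k₂, R_mulVec_k₃,
    Matrix.mul_add, Matrix.add_mul, Matrix.mul_smul, Matrix.smul_mul, R_conj_map_ofReal,
    R_conj_conj_transpose, R_conj_conj, Matrix.mul_one, h1]
  abel
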